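/- Let d ≥ 1, let N be a directed norm on E = EuclideanSpace ℝ (Fin d), and let μ > 1 be a real number. Then there exists δ₀ > 0 such that for every δ with 0 < δ ≤ δ₀ there exist nonempty finite sets S and S' of vectors in E, all of whose coordinates are integer multiples of δ, satisfying: N(v) ≤ max_{p ∈ S} ⟪p, v⟫ ≤ μ * N(v) for all v ∈ E, and μ⁻¹ * N(v) ≤ max_{p ∈ S'} ⟪p, v⟫ ≤ N(v) for all v ∈ E (⟪·,·⟫ denotes the Euclidean inner product). -/

import Mathlib

open scoped RealInnerProductSpace

/-- A directed norm on `EuclideanSpace ℝ (Fin d)`: subadditive, positively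
homogeneous and positive definite, but not necessarily symmetric. -/
def IsDirectedNorm {d : ℕ} (N : EuclideanSpace ℝ (Fin d) → ℝ) : Prop :=
  (∀ v w, N (v + w) ≤ N v + N w) ∧
    (∀ (c : ℝ) v, 0 ≤ c → N (c • v) = c * N v) ∧
    (∀ v, v ≠ 0 → 0 < N v)

namespace IsDirectedNorm

variable {d : ℕ} {N : EuclideanSpace ℝ (Fin d) → ℝ}

lemma map_zero (hN : IsDirectedNorm N) : N 0 = 0 := by
  simpa using hN.2.1 0 0 le_rfl

lemma nonneg (hN : IsDirectedNorm N) (v : EuclideanSpace ℝ (Fin d)) : 0 ≤ N v := by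
  by_cases hv : v = 0
  · rw [hv, hN.map_zero]
  · exact (hN.2.2 v hv).le

lemma const_mul (hN : IsDirectedNorm N) {a : ℝ} (ha : 0 < a) :
    IsDirectedNorm (fun v => a * N v) := by
  refine ⟨fun v w => ?_, fun c v hc => ?_, fun v hv => mul_pos ha (hN.2.2 v hv)⟩
  · rw [← mul_add]
    exact mul_le_mul_of_nonneg_left (hN.1 v w) ha.le
  · simp only [hN.2.1 c v hc, mul_left_comm]

lemma continuous (hN : IsDirectedNorm N) : Continuous N := by
  have hconv : ConvexOn ℝ Set.univ N := by
    refine ⟨convex_univ, fun x _ y _ a b ha hb _ => ?_⟩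
    refine (hN.1 _ _).trans_eq ?_
    rw [hN.2.1 a x ha, hN.2.1 b y hb, smul_eq_mul, smul_eq_mul]
  exact hconv.locallyLipschitz.continuous

/-- A directed norm dominates a positive multiple of the Euclidean norm. -/
lemma exists_pos_mul_norm_le (hN : IsDirectedNorm N) :
    ∃ c : ℝ, 0 < c ∧ ∀ v, c * ‖v‖ ≤ N v := by
  have hpos : ∀ v ∈ Metric.sphere (0 : EuclideanSpace ℝ (Fin d)) 1, 0 < N v := fun v hv =>
    hN.2.2 v (ne_zero_of_mem_unit_sphere ⟨v, hv⟩)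
  obtain ⟨c, hc, hcN⟩ := (isCompact_sphere _ _).exists_forall_le' hN.continuous.continuousOn hpos
  refine ⟨c, hc, fun v => ?_⟩
  by_cases hv : v = 0
  · simp [hv, hN.map_zero]
  · have hv' : 0 < ‖v‖ := norm_pos_iff.2 hv
    have h := hcN (‖v‖⁻¹ • v) (by simp [norm_smul, hv])
    rwa [hN.2.1 _ v (by positivity), inv_mul_eq_div, le_div_iff₀ hv'] at h

/-- Every vector has a supporting functional in the dual unit ball of a directed norm. -/
lemma exists_inner_eq (hN : IsDirectedNorm N) (v : EuclideanSpace ℝ (Fin d)) :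
    ∃ p : EuclideanSpace ℝ (Fin d), ⟪p, v⟫ = N v ∧ ∀ w, ⟪p, w⟫ ≤ N w := by
  have H : ∀ c : ℝ, c • v = 0 → c • N v = 0 := fun c hc => by
    rcases smul_eq_zero.1 hc with rfl | rfl
    · simp
    · simp [hN.map_zero]
  let f : EuclideanSpace ℝ (Fin d) →ₗ.[ℝ] ℝ := LinearPMap.mkSpanSingleton' v (N v) H
  obtain ⟨g, hgf, hgN⟩ := exists_extension_of_le_sublinear f N
    (fun c hc x => hN.2.1 c x hc.le) hN.1 (by
      rintro ⟨x, hx⟩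
      obtain ⟨c, rfl⟩ := Submodule.mem_span_singleton.1 hx
      refine (LinearPMap.mkSpanSingleton'_apply v (N v) H c hx).trans_le ?_
      rcases le_total 0 c with hc | hc
      · exact (hN.2.1 c v hc).ge
      · exact (mul_nonpos_of_nonpos_of_nonneg hc (hN.nonneg v)).trans (hN.nonneg _))
  refine ⟨(InnerProductSpace.toDual ℝ _).symm (LinearMap.toContinuousLinearMap g), ?_, fun w => ?_⟩
  · rw [InnerProductSpace.toDual_symm_apply]
    exact (hgf ⟨v, Submodule.mem_span_singleton_self v⟩).trans
      (LinearPMap.mkSpanSingleton'_apply_self v (N v) H _)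
  · rw [InnerProductSpace.toDual_symm_apply]
    exact hgN w

end IsDirectedNorm

/-- A real number can be rounded to a multiple of `δ` in the direction given by the sign of `t`. -/
lemma exists_int_mul_abs_sub_le {δ : ℝ} (hδ : 0 < δ) (x t : ℝ) :
    ∃ m : ℤ, |m * δ - x| ≤ δ ∧ x * t ≤ m * δ * t := by
  have hx : x / δ * δ = x := div_mul_cancel₀ x hδ.ne'
  rcases le_total 0 t with ht | ht
  · have h₁ : x ≤ ⌈x / δ⌉ * δ := by
      simpa only [hx] using mul_le_mul_of_nonneg_right (Int.le_ceil (x / δ)) hδ.le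
    have h₂ : ⌈x / δ⌉ * δ ≤ x + δ := by
      simpa only [add_mul, hx, one_mul] using
        mul_le_mul_of_nonneg_right (Int.ceil_lt_add_one (x / δ)).le hδ.le
    exact ⟨⌈x / δ⌉, abs_le.2 ⟨by linarith, by linarith⟩, mul_le_mul_of_nonneg_right h₁ ht⟩
  · have h₁ : ⌊x / δ⌋ * δ ≤ x := by
      simpa only [hx] using mul_le_mul_of_nonneg_right (Int.floor_le (x / δ)) hδ.le
    have h₂ : x ≤ ⌊x / δ⌋ * δ + δ := by
      simpa only [add_mul, hx, one_mul] using
        mul_le_mul_of_nonneg_right (Int.lt_floor_add_one (x / δ)).le hδ.le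
    exact ⟨⌊x / δ⌋, abs_le.2 ⟨by linarith, by linarith⟩, mul_le_mul_of_nonpos_right h₁ ht⟩

lemma EuclideanSpace.real_inner_eq_sum_mul {d : ℕ} (p v : EuclideanSpace ℝ (Fin d)) :
    ⟪p, v⟫ = ∑ i, p i * v i := by
  simp [PiLp.inner_apply, mul_comm]

/-- A vector can be rounded to `(δℤ)^d` without decreasing its inner product with `v`. -/
lemma exists_lattice_inner_le {d : ℕ} {δ : ℝ} (hδ : 0 < δ) (p v : EuclideanSpace ℝ (Fin d)) :
    ∃ q : EuclideanSpace ℝ (Fin d), (∀ i, ∃ m : ℤ, q i = m * δ) ∧ ⟪p, v⟫ ≤ ⟪q, v⟫ ∧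
      ∀ w, ⟪q, w⟫ ≤ ⟪p, w⟫ + d * δ * ‖w‖ := by
  choose m hm hmv using fun i => exists_int_mul_abs_sub_le hδ (p i) (v i)
  refine ⟨WithLp.toLp 2 fun i => m i * δ, fun i => ⟨m i, rfl⟩, ?_, fun w => ?_⟩
  · simp only [EuclideanSpace.real_inner_eq_sum_mul]
    exact Finset.sum_le_sum fun i _ => hmv i
  · rw [← sub_le_iff_le_add', ← inner_sub_left]
    have hi : ∀ i, (m i * δ - p i) * w i ≤ δ * ‖w‖ := fun i => by
      refine (le_abs_self _).trans ?_
      rw [abs_mul]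
      exact mul_le_mul (hm i) (PiLp.norm_apply_le w i) (abs_nonneg _) hδ.le
    simp only [EuclideanSpace.real_inner_eq_sum_mul, PiLp.sub_apply]
    refine (Finset.sum_le_card_nsmul _ _ _ fun i _ => hi i).trans_eq ?_
    simp [mul_assoc]

/-- Only finitely many `δ`-lattice vectors define functionals dominated by a given function. -/
lemma finite_setOf_lattice_inner_le {d : ℕ} {N : EuclideanSpace ℝ (Fin d) → ℝ}
    {δ : ℝ} (hδ : 0 < δ) :
    {p : EuclideanSpace ℝ (Fin d) |
      (∀ i, ∃ m : ℤ, p i = m * δ) ∧ ∀ v, ⟪p, v⟫ ≤ N v}.Finite := by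
  let e : Fin d → EuclideanSpace ℝ (Fin d) := fun i => EuclideanSpace.single i 1
  let box : Set (Fin d → ℤ) :=
    Set.univ.pi fun i => Set.Icc ⌊-N (-e i) / δ⌋ ⌈N (e i) / δ⌉
  have hbox : box.Finite := Set.Finite.pi fun i => Set.finite_Icc _ _
  refine (hbox.image fun m => WithLp.toLp 2 fun i => (m i : ℝ) * δ).subset ?_
  rintro p ⟨hp, hpN⟩
  choose m hm using hp
  refine ⟨m, fun i _ => ⟨?_, ?_⟩, ?_⟩
  · have h := hpN (-e i)
    simp only [e, inner_neg_right, EuclideanSpace.inner_single_right, hm] at h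
    have h' : -N (-e i) / δ ≤ m i := by
      rw [div_le_iff₀ hδ]
      simp at h
      linarith
    exact_mod_cast (Int.floor_le _).trans h'
  · have h := hpN (e i)
    simp only [e, EuclideanSpace.inner_single_right, hm] at h
    have h' : (m i : ℝ) ≤ N (e i) / δ := by
      rw [le_div_iff₀ hδ]
      simpa using h
    exact_mod_cast h'.trans (Int.le_ceil _)
  · ext i
    exact (hm i).symm

/-- Approximation of a directed norm from above by `δ`-integral norms. -/
lemma IsDirectedNorm.exists_lattice_approx_above {d : ℕ} {N : EuclideanSpace ℝ (Fin d) → ℝ}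
    (hN : IsDirectedNorm N) {μ : ℝ} (hμ : 1 < μ) :
    ∃ δ₀ : ℝ, 0 < δ₀ ∧ ∀ δ : ℝ, 0 < δ → δ ≤ δ₀ →
      ∃ (S : Finset (EuclideanSpace ℝ (Fin d))) (hS : S.Nonempty),
        (∀ p ∈ S, ∀ i : Fin d, ∃ m : ℤ, p i = (m : ℝ) * δ) ∧
        ∀ v : EuclideanSpace ℝ (Fin d),
          N v ≤ S.sup' hS (fun p => ⟪p, v⟫) ∧ S.sup' hS (fun p => ⟪p, v⟫) ≤ μ * N v := by
  obtain ⟨c, hc, hcN⟩ := hN.exists_pos_mul_norm_le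
  have hμ' : 0 < μ - 1 := sub_pos.2 hμ
  refine ⟨(μ - 1) * c / (d + 1), by positivity, fun δ hδ hδ₀ => ?_⟩
  rw [le_div_iff₀ (by positivity)] at hδ₀
  have hfin := finite_setOf_lattice_inner_le (N := fun v => μ * N v) hδ
  refine ⟨hfin.toFinset, ⟨0, ?_⟩, ?_, fun v => ⟨?_, ?_⟩⟩
  · refine hfin.mem_toFinset.2 ⟨fun i => ⟨0, by simp⟩, fun v => ?_⟩
    rw [inner_zero_left]
    exact (hN.const_mul (zero_lt_one.trans hμ)).nonneg v
  · exact fun p hp => (hfin.mem_toFinset.1 hp).1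
  · obtain ⟨p, hpv, hpN⟩ := hN.exists_inner_eq v
    obtain ⟨q, hq, hqv, hqp⟩ := exists_lattice_inner_le hδ p v
    refine (hpv.symm.trans_le hqv).trans (Finset.le_sup' (fun p => ⟪p, v⟫) ?_)
    refine hfin.mem_toFinset.2 ⟨hq, fun w => ?_⟩
    have hd : d * δ * ‖w‖ ≤ (μ - 1) * N w := calc
      d * δ * ‖w‖ ≤ (μ - 1) * c * ‖w‖ := by
        refine mul_le_mul_of_nonneg_right ?_ (norm_nonneg w)
        linarith
      _ = (μ - 1) * (c * ‖w‖) := mul_assoc _ _ _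
      _ ≤ (μ - 1) * N w := mul_le_mul_of_nonneg_left (hcN w) hμ'.le
    linarith [hqp w, hpN w]
  · exact Finset.sup'_le _ _ fun p hp => (hfin.mem_toFinset.1 hp).2 v

/-- Integral approximation of directed norms: for every directed norm `N` and
`μ > 1`, for all sufficiently small `δ > 0` there are `δ`-integral polyhedral
norms approximating `N` from above within factor `μ` and from below within
factor `μ⁻¹`. -/
theorem directed_norm_integral_approx (d : ℕ) (hd : 1 ≤ d)
    (N : EuclideanSpace ℝ (Fin d) → ℝ) (hN : IsDirectedNorm N)
    (μ : ℝ) (hμ : 1 < μ) :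
    ∃ δ₀ : ℝ, 0 < δ₀ ∧ ∀ δ : ℝ, 0 < δ → δ ≤ δ₀ →
      ∃ (S S' : Finset (EuclideanSpace ℝ (Fin d)))
        (hS : S.Nonempty) (hS' : S'.Nonempty),
        (∀ p ∈ S, ∀ i : Fin d, ∃ m : ℤ, p i = (m : ℝ) * δ) ∧
        (∀ p ∈ S', ∀ i : Fin d, ∃ m : ℤ, p i = (m : ℝ) * δ) ∧
        (∀ v : EuclideanSpace ℝ (Fin d),
          N v ≤ S.sup' hS (fun p => ⟪p, v⟫) ∧
            S.sup' hS (fun p => ⟪p, v⟫) ≤ μ * N v) ∧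
        (∀ v : EuclideanSpace ℝ (Fin d),
          μ⁻¹ * N v ≤ S'.sup' hS' (fun p => ⟪p, v⟫) ∧
            S'.sup' hS' (fun p => ⟪p, v⟫) ≤ N v) := by
  have hμ₀ : 0 < μ := zero_lt_one.trans hμ
  obtain ⟨δ₁, hδ₁, h₁⟩ := hN.exists_lattice_approx_above hμ
  obtain ⟨δ₂, hδ₂, h₂⟩ := (hN.const_mul (inv_pos.2 hμ₀)).exists_lattice_approx_above hμ
  refine ⟨min δ₁ δ₂, lt_min hδ₁ hδ₂, fun δ hδ hδ₀ => ?_⟩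
  obtain ⟨S, hS, hSδ, hSN⟩ := h₁ δ hδ (hδ₀.trans (min_le_left _ _))
  obtain ⟨S', hS', hSδ', hSN'⟩ := h₂ δ hδ (hδ₀.trans (min_le_right _ _))
  refine ⟨S, S', hS, hS', hSδ, hSδ', hSN, fun v => ⟨(hSN' v).1, ?_⟩⟩
  simpa only [mul_inv_cancel_left₀ hμ₀.ne'] using (hSN' v).2
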